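/- Let $\mathcal P = \{P^j\}_{j=1}^d$ with $\sup_{i,j} p^j_i < \infty$, let $\Psi$ be a complex-valued additive function on the $\mathcal P$-adic parallelepipeds of $I_0 = [0,1]^d$, and for $x$ in the interior of a parallelepiped $I_{ki}$ of rank $k$ set $\Psi_k(x) = \Psi(I_{ki})/\mu(I_{ki})$. If there exists a sequence $\{h_m\}$ satisfying (h1)–(h3) on $I_0$ with $\lim_{m \to \infty} \int_{\{x \in I_0 : \Psi^*(x) > h_m(x)\}} h_m(x)\,dx = 0$, then the sequence $\Psi_k(x)$ converges for almost every $x \in I_0$; in particular $\Psi'(x)$ exists almost everywhere. -/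

import Mathlib

open MeasureTheory Filter Topology

noncomputable section

/-- `mseq p k = ∏_{i<k} p i`, i.e. the product `m_k = p_1 ⋯ p_k` generated by the
sequence `p` (indexed from `0` in Lean). -/
def mseq (p : ℕ → ℕ) (k : ℕ) : ℕ := ∏ i ∈ Finset.range k, p i

/-- The `𝒫`-adic parallelepiped of rank `k` with corner index `n`, i.e.
`[n₁/m¹ₖ, (n₁+1)/m¹ₖ] × ⋯ × [n_d/mᵈₖ, (n_d+1)/mᵈₖ]`. -/
def cell {d : ℕ} (p : Fin d → ℕ → ℕ) (k : ℕ) (n : Fin d → ℤ) : Set (Fin d → ℝ) :=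
  Set.univ.pi fun j =>
    Set.Icc ((n j : ℝ) / (mseq (p j) k : ℝ)) (((n j : ℝ) + 1) / (mseq (p j) k : ℝ))

/-- `Λᵈ`, the collection of all `𝒫`-adic parallelepipeds (of all ranks). -/
def Lambda {d : ℕ} (p : Fin d → ℕ → ℕ) : Set (Set (Fin d → ℝ)) :=
  {I | ∃ k n, I = cell p k n}

/-- `Ψ` is additive on the `𝒫`-adic parallelepipeds: whenever `I ∈ Λᵈ` is the union of
finitely many members of `Λᵈ` with pairwise disjoint interiors, `Ψ I` is the sum of their
values. -/
def IsAdditive {d : ℕ} (p : Fin d → ℕ → ℕ) (Ψ : Set (Fin d → ℝ) → ℂ) : Prop :=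
  ∀ (I : Set (Fin d → ℝ)) (s : ℕ) (J : Fin s → Set (Fin d → ℝ)),
    I ∈ Lambda p → (∀ i, J i ∈ Lambda p) →
    (∀ i j, i ≠ j → Disjoint (interior (J i)) (interior (J j))) →
    (⋃ i, J i) = I → Ψ I = ∑ i, Ψ (J i)

/-- The `𝒫`-adic parallelepiped of rank `k` containing `x`; for a `𝒫`-irrational point `x`
it is the unique member of `Λᵈ_k` containing `x`. -/
def cellAt {d : ℕ} (p : Fin d → ℕ → ℕ) (k : ℕ) (x : Fin d → ℝ) : Set (Fin d → ℝ) :=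
  cell p k fun j => ⌊x j * (mseq (p j) k : ℝ)⌋

/-- The set `{x | Ψ*(x) > lam x}`, where `Ψ*(x) = sup {‖Ψ I‖/μ(I) | I ∈ Λᵈ, x ∈ I}` is the
majorant of `Ψ`. -/
def starGt {d : ℕ} (p : Fin d → ℕ → ℕ) (Ψ : Set (Fin d → ℝ) → ℂ)
    (lam : (Fin d → ℝ) → ℝ) : Set (Fin d → ℝ) :=
  {x | ∃ I ∈ Lambda p, x ∈ I ∧ lam x < ‖Ψ I‖ / (volume I).toReal}

/-- Truncation of `f` by the function `lam`: `[f(x)]_{lam(x)}`. -/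
def trunc {α : Type*} (f : α → ℂ) (lam : α → ℝ) (x : α) : ℂ :=
  if ‖f x‖ ≤ lam x then f x else 0

/-- Conditions (h1)–(h3) on the sequence of functions `h m : I₀ → ℝ`:
(h1) `0 ≤ h 1 ≤ h 2 ≤ ⋯` and `h m x → ∞` on `I₀`; (h2)–(h3) there are a constant `C > 0`
and, for each `m`, parallelepipeds `J 1, …, J s ∈ Λᵈ` with pairwise disjoint interiors and
union `I₀` on each of which `sup h m ≤ C * inf h m`, and with `inf_{m,i} ∫_{J i} h m > 0`. -/
def HConds {d : ℕ} (p : Fin d → ℕ → ℕ) (I0 : Set (Fin d → ℝ))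
    (h : ℕ → (Fin d → ℝ) → ℝ) : Prop :=
  (∀ x ∈ I0, (∀ m, 0 ≤ h m x) ∧ (Monotone fun m => h m x) ∧
      Tendsto (fun m => h m x) atTop atTop) ∧
  ∃ C > (0 : ℝ), ∃ ε > (0 : ℝ), ∀ m : ℕ, ∃ (s : ℕ) (J : Fin s → Set (Fin d → ℝ)),
    (∀ i, J i ∈ Lambda p) ∧
    (∀ i j, i ≠ j → Disjoint (interior (J i)) (interior (J j))) ∧
    (⋃ i, J i) = I0 ∧
    (∀ i, ∀ x ∈ J i, ∀ y ∈ J i, h m x ≤ C * h m y) ∧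
    (∀ i, ε ≤ ∫ x in J i, h m x)

theorem ae_tendsto_of_abs_le_of_regular {Ω : Type*} {m0 : MeasurableSpace Ω} {μ : Measure Ω}
    [IsFiniteMeasure μ] {ℱ : Filtration ℕ m0} {f : ℕ → Ω → ℝ} (hf : Martingale f ℱ μ)
    {c : ℝ} (hc : 0 < c)
    (hreg : ∀ k B, MeasurableSet[ℱ (k + 1)] B →
      ∀ᵐ x ∂μ, x ∈ B → c ≤ (μ[B.indicator (1 : Ω → ℝ) | ℱ k]) x) (R : NNReal) :
    ∀ᵐ x ∂μ, (∀ k, |f k x| ≤ R) → ∃ l, Tendsto (fun k => f k x) atTop (𝓝 l) := by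
  set B : ℕ → Set Ω := fun k => {x | (R : ℝ) < |f k x|} with hB
  have hBm : ∀ k, MeasurableSet[ℱ k] (B k) := fun k =>
    (hf.stronglyMeasurable k).norm.measurable measurableSet_Ioi
  set A : ℕ → Set Ω := fun k =>
    {x | (μ[(B (k + 1)).indicator (1 : Ω → ℝ) | ℱ k]) x < c} with hA
  have hAm : ∀ k, MeasurableSet[ℱ k] (A k) := fun k =>
    (stronglyMeasurable_condExp (f := (B (k + 1)).indicator (1 : Ω → ℝ)) (μ := μ)
      (m := ℱ k)).measurable measurableSet_Iio
  set g : ℕ → Ω → ℝ := fun n =>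
    ∑ k ∈ Finset.range n, (A k).indicator (f (k + 1) - f k) with hg
  have hgsucc : ∀ n, g (n + 1) - g n = (A n).indicator (f (n + 1) - f n) := fun n => by
    simp only [hg, Finset.sum_range_succ, add_sub_cancel_left]
  have hdint : ∀ k, Integrable (f (k + 1) - f k) μ := fun k =>
    (hf.integrable _).sub (hf.integrable _)
  have hgm : Martingale g ℱ μ := by
    refine martingale_of_condExp_sub_eq_zero_nat ?_ ?_ ?_
    · intro n
      refine Finset.stronglyMeasurable_sum _ fun k hk => ?_
      have hkn : k + 1 ≤ n := Finset.mem_range.1 hk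
      exact (((hf.stronglyMeasurable (k + 1)).mono (ℱ.mono hkn)).sub
        ((hf.stronglyMeasurable k).mono (ℱ.mono (by omega)))).indicator
        (ℱ.mono (by omega : k ≤ n) _ (hAm k))
    · intro n
      exact integrable_finsetSum' _ fun k _ => (hdint k).indicator (ℱ.le k _ (hAm k))
    · intro n
      rw [hgsucc]
      refine (condExp_indicator (hdint n) (hAm n)).trans ?_
      have h1 : μ[f (n + 1) - f n | ℱ n] =ᵐ[μ] 0 := by
        refine (condExp_sub (hf.integrable _) (hf.integrable _) _).trans ?_
        filter_upwards [hf.condExp_ae_eq (Nat.le_succ n), hf.condExp_ae_eq (le_refl n)]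
          with x h1 h2
        simp [h1, h2]
      filter_upwards [h1] with x hx
      by_cases hxA : x ∈ A n <;> simp [hxA, hx]
  have hbdd : ∀ᵐ x ∂μ, ∀ n, |g (n + 1) x - g n x| ≤ ((2 * R : NNReal) : ℝ) := by
    refine ae_all_iff.2 fun n => ?_
    have hsucc : ∀ᵐ x ∂μ, |(A n).indicator (f (n + 1)) x| ≤ R := by
      filter_upwards [hreg n _ (hBm (n + 1))] with x hx
      by_cases hxA : x ∈ A n
      · rw [Set.indicator_of_mem hxA]
        by_contra hlt
        exact absurd (hx (not_le.1 hlt)) (not_le.2 hxA)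
      · simp [hxA]
    have hcur : ∀ᵐ x ∂μ, |(A n).indicator (f n) x| ≤ R := by
      filter_upwards [ae_bdd_abs_condExp_of_ae_bdd_abs (m := ℱ n) hsucc,
        condExp_indicator (hf.integrable (n + 1)) (hAm n),
        hf.condExp_ae_eq (Nat.le_succ n)] with x h1 h2 h3
      have h4 : |(μ[(A n).indicator (f (n + 1)) | ℱ n]) x| ≤ R := h1
      rw [h2] at h4
      by_cases hxA : x ∈ A n
      · rw [Set.indicator_of_mem hxA] at h4 ⊢
        rwa [← h3]
      · simp [hxA]
    filter_upwards [hsucc, hcur] with x h1 h2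
    have h3 : g (n + 1) x - g n x
        = (A n).indicator (f (n + 1)) x - (A n).indicator (f n) x := by
      rw [← Pi.sub_apply, hgsucc]
      by_cases hxA : x ∈ A n <;> simp [hxA]
    rw [h3, NNReal.coe_mul, NNReal.coe_ofNat]
    exact (abs_sub _ _).trans (by linarith)
  have hnonneg : ∀ᵐ x ∂μ, ∀ k, 0 ≤ (μ[(B (k + 1)).indicator (1 : Ω → ℝ) | ℱ k]) x :=
    ae_all_iff.2 fun k => condExp_nonneg
      (Eventually.of_forall fun x => Set.indicator_nonneg (fun _ _ => zero_le_one) x)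
  filter_upwards [hgm.submartingale.bddAbove_iff_exists_tendsto hbdd, hnonneg,
    ae_mem_limsup_atTop_iff μ hBm] with x hconv hnn hBC hfx
  have hsum : Summable fun k => (μ[(B (k + 1)).indicator (1 : Ω → ℝ) | ℱ k]) x := by
    rw [summable_iff_not_tendsto_nat_atTop_of_nonneg hnn, ← hBC, mem_limsup_iff_frequently_mem]
    intro hfreq
    obtain ⟨k, hk⟩ := hfreq.exists
    exact absurd (hfx k) (not_le.2 hk)
  obtain ⟨n, hn⟩ := eventually_atTop.1 (hsum.tendsto_atTop_zero.eventually_lt_const hc)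
  have hgf : ∀ k, n ≤ k → g k x = f k x + (g n x - f n x) := by
    intro k hk
    induction k, hk using Nat.le_induction with
    | base => ring
    | succ k hk ih =>
      have h1 := congrFun (hgsucc k) x
      rw [Set.indicator_of_mem (show x ∈ A k from hn k hk)] at h1
      simp only [Pi.sub_apply] at h1
      linarith
  have hgb : BddAbove (Set.range fun k => g k x) := by
    refine IsBoundedUnder.bddAbove_range (f := fun k => g k x) ?_
    refine isBoundedUnder_of_eventually_le (a := R + (g n x - f n x)) ?_
    filter_upwards [eventually_ge_atTop n] with k hk
    rw [hgf k hk]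
    gcongr
    exact (le_abs_self _).trans (hfx k)
  obtain ⟨l, hl⟩ := hconv.1 hgb
  refine ⟨l - (g n x - f n x), (hl.sub_const _).congr' ?_⟩
  filter_upwards [eventually_ge_atTop n] with k hk
  rw [hgf k hk]
  ring

/-- The corner index of the half-open `𝒫`-adic parallelepiped of rank `k` containing `x`. -/
def cellIndex {d : ℕ} (p : Fin d → ℕ → ℕ) (k : ℕ) (x : Fin d → ℝ) : Fin d → ℤ :=
  fun j => ⌊x j * (mseq (p j) k : ℝ)⌋

/-- The corner index of a child, of rank `k + 1`, of the parallelepiped of rank `k` with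
corner index `n`. -/
def childIndex {d : ℕ} (p : Fin d → ℕ → ℕ) (k : ℕ) (n : Fin d → ℤ)
    (i : ∀ j, Fin (p j k)) : Fin d → ℤ :=
  fun j => n j * (p j k : ℤ) + (i j : ℕ)

/-- The average of `g` over the children of the parallelepiped of rank `k` with corner
index `n`. -/
def childAverage {d : ℕ} (p : Fin d → ℕ → ℕ) (k : ℕ) (g : (Fin d → ℤ) → ℝ)
    (n : Fin d → ℤ) : ℝ :=
  (∑ i : ∀ j, Fin (p j k), g (childIndex p k n i)) / ∏ j, (p j k : ℝ)

section Grid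

variable {d : ℕ} {p : Fin d → ℕ → ℕ}

theorem mseq_succ (q : ℕ → ℕ) (k : ℕ) : mseq q (k + 1) = mseq q k * q k :=
  Finset.prod_range_succ _ _

theorem mseq_pos {q : ℕ → ℕ} (hq : ∀ i, 0 < q i) (k : ℕ) : 0 < mseq q k :=
  Finset.prod_pos fun i _ => hq i

theorem cellIndex_succ_ediv (hp : ∀ j i, 0 < p j i) (k : ℕ) (x : Fin d → ℝ) (j : Fin d) :
    cellIndex p (k + 1) x j / (p j k : ℤ) = cellIndex p k x j := by
  have hpos : (0 : ℝ) < p j k := Nat.cast_pos.2 (hp j k)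
  have h1 : x j * (mseq (p j) k : ℝ) = x j * (mseq (p j) (k + 1) : ℝ) / (p j k : ℕ) := by
    rw [mseq_succ, Nat.cast_mul]
    field_simp
  simp only [cellIndex]
  rw [h1, Int.floor_div_natCast]

theorem cellIndex_preimage_singleton (hp : ∀ j i, 0 < p j i) (k : ℕ) (n : Fin d → ℤ) :
    cellIndex p k ⁻¹' {n} = Set.univ.pi fun j =>
      Set.Ico ((n j : ℝ) / (mseq (p j) k : ℝ)) (((n j : ℝ) + 1) / (mseq (p j) k : ℝ)) := by
  ext x
  simp only [Set.mem_preimage, Set.mem_singleton_iff, funext_iff, cellIndex, Int.floor_eq_iff,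
    Set.mem_pi, Set.mem_univ, true_imp_iff, Set.mem_Ico]
  refine forall_congr' fun j => ?_
  have hm : (0 : ℝ) < mseq (p j) k := Nat.cast_pos.2 (mseq_pos (hp j) k)
  rw [div_le_iff₀ hm, lt_div_iff₀ hm]

theorem cell_eq_Icc (p : Fin d → ℕ → ℕ) (k : ℕ) (n : Fin d → ℤ) :
    cell p k n = Set.Icc (fun j => (n j : ℝ) / (mseq (p j) k : ℝ))
      (fun j => ((n j : ℝ) + 1) / (mseq (p j) k : ℝ)) :=
  Set.pi_univ_Icc _ _

theorem cellIndex_preimage_ae_eq_cell (hp : ∀ j i, 0 < p j i) (k : ℕ) (n : Fin d → ℤ) :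
    cellIndex p k ⁻¹' {n} =ᵐ[volume] cell p k n := by
  rw [cellIndex_preimage_singleton hp, cell_eq_Icc]
  exact Measure.univ_pi_Ico_ae_eq_Icc

theorem mem_cellAt (hp : ∀ j i, 0 < p j i) (k : ℕ) (x : Fin d → ℝ) : x ∈ cellAt p k x := by
  have h : x ∈ cellIndex p k ⁻¹' {cellIndex p k x} := rfl
  rw [cellIndex_preimage_singleton hp] at h
  exact Set.pi_mono (fun j _ => Set.Ico_subset_Icc_self) h

theorem volume_cell_toReal (p : Fin d → ℕ → ℕ) (k : ℕ) (n : Fin d → ℤ) :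
    (volume (cell p k n)).toReal = ∏ j, (mseq (p j) k : ℝ)⁻¹ := by
  rw [cell_eq_Icc, Real.volume_Icc_pi, ENNReal.toReal_prod]
  refine Finset.prod_congr rfl fun j _ => ?_
  rw [← sub_div, add_sub_cancel_left, one_div, ENNReal.toReal_ofReal (by positivity)]

theorem measureReal_cellIndex_preimage (hp : ∀ j i, 0 < p j i) (k : ℕ) (n : Fin d → ℤ) :
    volume.real (cellIndex p k ⁻¹' {n}) = ∏ j, (mseq (p j) k : ℝ)⁻¹ := by
  rw [← volume_cell_toReal p k n, measureReal_def,
    measure_congr (cellIndex_preimage_ae_eq_cell hp k n)]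

theorem volume_cell_ne_top (p : Fin d → ℕ → ℕ) (k : ℕ) (n : Fin d → ℤ) :
    volume (cell p k n) ≠ ⊤ := by
  rw [cell_eq_Icc]
  exact isCompact_Icc.measure_ne_top

theorem measurable_cellIndex (p : Fin d → ℕ → ℕ) (k : ℕ) : Measurable (cellIndex p k) :=
  measurable_pi_lambda _ fun j => Int.measurable_floor.comp
    ((measurable_pi_apply j).mul_const _)

theorem measurableSet_cellIndex_preimage (p : Fin d → ℕ → ℕ) (k : ℕ) (T : Set (Fin d → ℤ)) :
    MeasurableSet (cellIndex p k ⁻¹' T) :=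
  measurable_cellIndex p k (MeasurableSet.of_discrete)

theorem childIndex_ediv (k : ℕ) (n : Fin d → ℤ) (i : ∀ j, Fin (p j k)) (j : Fin d) :
    childIndex p k n i j / (p j k : ℤ) = n j := by
  have hi := (i j).2
  rw [childIndex, add_comm, Int.add_mul_ediv_right _ _ (by omega),
    Int.ediv_eq_zero_of_lt (by positivity) (by exact_mod_cast hi), zero_add]

theorem childIndex_injective (k : ℕ) (n : Fin d → ℤ) :
    Function.Injective (childIndex p k n) := by
  intro i i' h
  funext j
  have hj := congrFun h j
  simp only [childIndex] at hj
  exact Fin.ext (by omega)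

theorem exists_childIndex_eq (hp : ∀ j i, 0 < p j i) (k : ℕ) (x : Fin d → ℝ) :
    ∃ i, childIndex p k (cellIndex p k x) i = cellIndex p (k + 1) x := by
  have hpos : ∀ j, (0 : ℤ) < p j k := fun j => by exact_mod_cast hp j k
  refine ⟨fun j => ⟨(cellIndex p (k + 1) x j % (p j k : ℤ)).toNat, ?_⟩, ?_⟩
  · have h1 := Int.emod_lt_of_pos (cellIndex p (k + 1) x j) (hpos j)
    have h2 := Int.emod_nonneg (cellIndex p (k + 1) x j) (hpos j).ne'
    omega
  · funext j
    have h2 := Int.emod_nonneg (cellIndex p (k + 1) x j) (hpos j).ne'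
    simp only [childIndex]
    rw [← cellIndex_succ_ediv hp, Int.toNat_of_nonneg h2]
    exact Int.ediv_mul_add_emod _ _

theorem iUnion_cellIndex_preimage_child (hp : ∀ j i, 0 < p j i) (k : ℕ) (n : Fin d → ℤ) :
    ⋃ i, cellIndex p (k + 1) ⁻¹' {childIndex p k n i} = cellIndex p k ⁻¹' {n} := by
  ext x
  simp only [Set.mem_iUnion, Set.mem_preimage, Set.mem_singleton_iff]
  constructor
  · rintro ⟨i, hi⟩
    funext j
    rw [← cellIndex_succ_ediv hp, hi, childIndex_ediv]
  · rintro rfl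
    obtain ⟨i, hi⟩ := exists_childIndex_eq hp k x
    exact ⟨i, hi.symm⟩

theorem integrableOn_comp_cellIndex_self (hp : ∀ j i, 0 < p j i) (g : (Fin d → ℤ) → ℝ) (k : ℕ)
    (n : Fin d → ℤ) :
    IntegrableOn (fun x => g (cellIndex p k x)) (cellIndex p k ⁻¹' {n}) := by
  have hfin : volume (cellIndex p k ⁻¹' {n}) ≠ ⊤ := by
    rw [measure_congr (cellIndex_preimage_ae_eq_cell hp k n)]
    exact volume_cell_ne_top p k n
  refine (integrableOn_const (C := g n) hfin).congr_fun ?_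
    (measurableSet_cellIndex_preimage p k _)
  intro x hx
  simp only [show cellIndex p k x = n from hx]

theorem integrableOn_comp_cellIndex (hp : ∀ j i, 0 < p j i) (g : (Fin d → ℤ) → ℝ) (t : ℕ) :
    ∀ (k : ℕ) (n : Fin d → ℤ),
      IntegrableOn (fun x => g (cellIndex p (k + t) x)) (cellIndex p k ⁻¹' {n}) := by
  induction t with
  | zero => exact fun k n => integrableOn_comp_cellIndex_self hp g k n
  | succ t ih =>
    intro k n
    rw [← iUnion_cellIndex_preimage_child hp k n, integrableOn_finite_iUnion]
    intro i
    rw [show k + (t + 1) = k + 1 + t by ring]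
    exact ih _ _

theorem setIntegral_comp_cellIndex (hp : ∀ j i, 0 < p j i) (g : (Fin d → ℤ) → ℝ) (k : ℕ)
    (n : Fin d → ℤ) :
    ∫ x in cellIndex p k ⁻¹' {n}, g (cellIndex p k x)
      = (∏ j, (mseq (p j) k : ℝ)⁻¹) * g n := by
  rw [setIntegral_congr_fun (g := fun _ => g n) (measurableSet_cellIndex_preimage p k _),
    setIntegral_const, measureReal_cellIndex_preimage hp, smul_eq_mul]
  intro x hx
  simp only [show cellIndex p k x = n from hx]

theorem setIntegral_comp_cellIndex_succ (hp : ∀ j i, 0 < p j i) (g : (Fin d → ℤ) → ℝ) (k : ℕ)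
    (n : Fin d → ℤ) :
    ∫ x in cellIndex p k ⁻¹' {n}, g (cellIndex p (k + 1) x)
      = ∫ x in cellIndex p k ⁻¹' {n}, childAverage p k g (cellIndex p k x) := by
  rw [setIntegral_comp_cellIndex hp, ← iUnion_cellIndex_preimage_child hp k n,
    integral_iUnion_fintype (fun i => measurableSet_cellIndex_preimage p _ _) ?_
      (fun i => integrableOn_comp_cellIndex_self hp g _ _)]
  · simp only [setIntegral_comp_cellIndex hp, childAverage, ← Finset.mul_sum, mseq_succ,
      Nat.cast_mul, mul_inv, Finset.prod_mul_distrib, Finset.prod_inv_distrib]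
    rw [div_eq_mul_inv]
    ring
  · intro i i' hii'
    exact Disjoint.preimage _
      (Set.disjoint_singleton.2 fun h => hii' (childIndex_injective k n h))

/-- The filtration generated by the half-open `𝒫`-adic parallelepipeds. -/
def cellFiltration (p : Fin d → ℕ → ℕ) (hp : ∀ j i, 0 < p j i) :
    Filtration ℕ (inferInstance : MeasurableSpace (Fin d → ℝ)) where
  seq k := MeasurableSpace.comap (cellIndex p k) inferInstance
  mono' := by
    refine monotone_nat_of_le_succ fun k => ?_
    rintro _ ⟨T, -, rfl⟩
    refine ⟨(fun n j => n j / (p j k : ℤ)) ⁻¹' T, MeasurableSet.of_discrete, ?_⟩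
    ext x
    simp only [Set.mem_preimage, cellIndex_succ_ediv hp]
  le' k := (measurable_cellIndex p k).comap_le

theorem exists_preimage_of_measurableSet_cellFiltration {hp : ∀ j i, 0 < p j i} {k : ℕ}
    {s : Set (Fin d → ℝ)} (hs : MeasurableSet[cellFiltration p hp k] s) :
    ∃ T, cellIndex p k ⁻¹' T = s :=
  let ⟨T, _, hT⟩ := hs
  ⟨T, hT⟩

theorem stronglyMeasurable_comp_cellIndex {hp : ∀ j i, 0 < p j i} (g : (Fin d → ℤ) → ℝ)
    (k : ℕ) : StronglyMeasurable[cellFiltration p hp k] fun x => g (cellIndex p k x) :=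
  ((measurable_of_countable g).comp (comap_measurable (cellIndex p k))).stronglyMeasurable

theorem integrable_comp_cellIndex (hp : ∀ j i, 0 < p j i) (g : (Fin d → ℤ) → ℝ) (k : ℕ) :
    Integrable (fun x => g (cellIndex p k x))
      (volume.restrict (cellIndex p 0 ⁻¹' {0})) := by
  have h := integrableOn_comp_cellIndex hp g k 0 0
  rwa [zero_add] at h

theorem isFiniteMeasure_restrict_cellIndex_preimage (hp : ∀ j i, 0 < p j i) (k : ℕ)
    (n : Fin d → ℤ) :
    IsFiniteMeasure ((volume : Measure (Fin d → ℝ)).restrict (cellIndex p k ⁻¹' {n})) := by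
  refine isFiniteMeasure_restrict.2 ?_
  rw [measure_congr (cellIndex_preimage_ae_eq_cell hp k n)]
  exact volume_cell_ne_top p k n

theorem condExp_comp_cellIndex_succ (hp : ∀ j i, 0 < p j i) (g : (Fin d → ℤ) → ℝ) (k : ℕ) :
    (fun x => childAverage p k g (cellIndex p k x))
      =ᵐ[volume.restrict (cellIndex p 0 ⁻¹' {0})]
    (volume.restrict (cellIndex p 0 ⁻¹' {0}))[fun x => g (cellIndex p (k + 1) x) |
      cellFiltration p hp k] := by
  have := isFiniteMeasure_restrict_cellIndex_preimage hp 0 (0 : Fin d → ℤ)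
  refine ae_eq_condExp_of_forall_setIntegral_eq ((cellFiltration p hp).le k)
    (integrable_comp_cellIndex hp g (k + 1))
    (fun s _ _ => (integrable_comp_cellIndex hp _ k).integrableOn) (fun s hs _ => ?_)
    (stronglyMeasurable_comp_cellIndex _ k).aestronglyMeasurable
  have h0 : MeasurableSet[cellFiltration p hp k] (cellIndex p 0 ⁻¹' {(0 : Fin d → ℤ)}) :=
    (cellFiltration p hp).mono (Nat.zero_le k) _ ⟨_, MeasurableSet.of_discrete, rfl⟩
  obtain ⟨T, hT⟩ := exists_preimage_of_measurableSet_cellFiltration (hs.inter h0)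
  have hU : s ∩ cellIndex p 0 ⁻¹' {(0 : Fin d → ℤ)}
      = ⋃ n : T, cellIndex p k ⁻¹' {(n : Fin d → ℤ)} := by
    rw [← hT]
    ext x
    simp
  have hint : ∀ (l : ℕ) (g' : (Fin d → ℤ) → ℝ),
      IntegrableOn (fun x => g' (cellIndex p l x))
        (⋃ n : T, cellIndex p k ⁻¹' {(n : Fin d → ℤ)}) := fun l g' =>
    IntegrableOn.mono_set (integrable_comp_cellIndex hp g' l) (hU ▸ Set.inter_subset_right)
  have hdisj : Pairwise (Function.onFun Disjoint
      fun n : T => cellIndex p k ⁻¹' {(n : Fin d → ℤ)}) := fun n n' hn =>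
    Disjoint.preimage _ (Set.disjoint_singleton.2 fun h => hn (Subtype.ext h))
  rw [Measure.restrict_restrict ((cellFiltration p hp).le k _ hs), hU,
    integral_iUnion (fun n => measurableSet_cellIndex_preimage p k _) hdisj (hint k _),
    integral_iUnion (fun n => measurableSet_cellIndex_preimage p k _) hdisj (hint (k + 1) g)]
  exact tsum_congr fun n => (setIntegral_comp_cellIndex_succ hp g k n).symm

theorem ae_tendsto_of_childAverage (hp : ∀ j i, 0 < p j i) {M : ℕ} (hM : ∀ j i, p j i ≤ M)
    {v : ℕ → (Fin d → ℤ) → ℝ} (hv : ∀ k n, v k n = childAverage p k (v (k + 1)) n) :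
    ∀ᵐ x ∂volume.restrict (cellIndex p 0 ⁻¹' {0}),
      (∃ R : ℝ, ∀ k, |v k (cellIndex p k x)| ≤ R) →
        ∃ l, Tendsto (fun k => v k (cellIndex p k x)) atTop (𝓝 l) := by
  have := isFiniteMeasure_restrict_cellIndex_preimage hp 0 (0 : Fin d → ℤ)
  have hmart : Martingale (fun k x => v k (cellIndex p k x)) (cellFiltration p hp)
      (volume.restrict (cellIndex p 0 ⁻¹' {0})) := by
    refine martingale_nat (fun k => stronglyMeasurable_comp_cellIndex _ k)
      (fun k => integrable_comp_cellIndex hp _ k) fun k => ?_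
    simp only [hv k]
    exact condExp_comp_cellIndex_succ hp _ k
  have hprod : ∀ k, 0 < ∏ j, (p j k : ℝ) := fun k =>
    Finset.prod_pos fun j _ => Nat.cast_pos.2 (hp j k)
  have hprodM : ∀ k, ∏ j, (p j k : ℝ) ≤ (M : ℝ) ^ d := fun k => by
    refine (Finset.prod_le_prod (fun j _ => Nat.cast_nonneg _)
      (fun j _ => Nat.cast_le.2 (hM j k))).trans ?_
    simp
  have hMd : (0 : ℝ) < (M : ℝ) ^ d := (hprod 0).trans_le (hprodM 0)
  have hreg : ∀ k B, MeasurableSet[cellFiltration p hp (k + 1)] B →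
      ∀ᵐ x ∂volume.restrict (cellIndex p 0 ⁻¹' {0}), x ∈ B → ((M : ℝ) ^ d)⁻¹ ≤
        ((volume.restrict (cellIndex p 0 ⁻¹' {0}))[B.indicator (1 : (Fin d → ℝ) → ℝ) |
          cellFiltration p hp k]) x := by
    intro k B hB
    obtain ⟨T, rfl⟩ := exists_preimage_of_measurableSet_cellFiltration hB
    filter_upwards [condExp_comp_cellIndex_succ hp (T.indicator 1) k] with x hx hxT
    have hcomp : (cellIndex p (k + 1) ⁻¹' T).indicator (1 : (Fin d → ℝ) → ℝ)
        = fun x => T.indicator (1 : (Fin d → ℤ) → ℝ) (cellIndex p (k + 1) x) := rfl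
    rw [hcomp, ← hx, childAverage]
    obtain ⟨i, hi⟩ := exists_childIndex_eq hp k x
    have h1 : (1 : ℝ) ≤ ∑ i, T.indicator (1 : (Fin d → ℤ) → ℝ)
        (childIndex p k (cellIndex p k x) i) := by
      refine le_trans (le_of_eq ?_) (Finset.single_le_sum
        (fun i _ => Set.indicator_nonneg (fun _ _ => zero_le_one) _) (Finset.mem_univ i))
      rw [hi]
      exact (Set.indicator_of_mem (show cellIndex p (k + 1) x ∈ T from hxT)
        (1 : (Fin d → ℤ) → ℝ)).symm
    rw [inv_eq_one_div]
    exact div_le_div₀ (zero_le_one.trans h1) h1 (hprod k) (hprodM k)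
  have h := ae_all_iff.2 fun N : ℕ =>
    ae_tendsto_of_abs_le_of_regular hmart (inv_pos.2 hMd) hreg N
  filter_upwards [h] with x hx
  rintro ⟨R, hR⟩
  obtain ⟨N, hN⟩ := exists_nat_ge R
  exact hx N fun k => (hR k).trans (by simpa using hN)

theorem interior_cell (p : Fin d → ℕ → ℕ) (k : ℕ) (n : Fin d → ℤ) :
    interior (cell p k n) = Set.univ.pi fun j =>
      Set.Ioo ((n j : ℝ) / (mseq (p j) k : ℝ)) (((n j : ℝ) + 1) / (mseq (p j) k : ℝ)) := by
  rw [cell, interior_pi_set Set.finite_univ]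
  simp only [interior_Icc]

theorem disjoint_interior_cell (hp : ∀ j i, 0 < p j i) (k : ℕ) {n n' : Fin d → ℤ}
    (hn : n ≠ n') : Disjoint (interior (cell p k n)) (interior (cell p k n')) := by
  have hsub : ∀ m, interior (cell p k m) ⊆ cellIndex p k ⁻¹' {m} := fun m => by
    rw [interior_cell, cellIndex_preimage_singleton hp]
    exact Set.pi_mono fun j _ => Set.Ioo_subset_Ico_self
  exact (Disjoint.preimage _ (Set.disjoint_singleton.2 hn)).mono (hsub n) (hsub n')

theorem iUnion_cell_child (hp : ∀ j i, 0 < p j i) (k : ℕ) (n : Fin d → ℤ) :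
    ⋃ i, cell p (k + 1) (childIndex p k n i) = cell p k n := by
  have hcl : ∀ l m, closure (cellIndex p l ⁻¹' {m}) = cell p l m := fun l m => by
    rw [cellIndex_preimage_singleton hp, closure_pi_set, cell]
    congr 1
    funext j
    have hm : (0 : ℝ) < mseq (p j) l := Nat.cast_pos.2 (mseq_pos (hp j) l)
    exact closure_Ico (div_lt_div_of_pos_right (lt_add_one _) hm).ne
  simp only [← hcl]
  rw [← iUnion_cellIndex_preimage_child hp k n, closure_iUnion_of_finite]

theorem IsAdditive.eq_sum_child {Ψ : Set (Fin d → ℝ) → ℂ} (hΨ : IsAdditive p Ψ)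
    (hp : ∀ j i, 0 < p j i) (k : ℕ) (n : Fin d → ℤ) :
    Ψ (cell p k n) = ∑ i, Ψ (cell p (k + 1) (childIndex p k n i)) := by
  let e := Fintype.equivFin (∀ j, Fin (p j k))
  rw [hΨ (cell p k n) _ (fun a => cell p (k + 1) (childIndex p k n (e.symm a))) ⟨k, n, rfl⟩
    (fun a => ⟨_, _, rfl⟩)
    (fun a b hab => disjoint_interior_cell hp _
      fun h => hab (e.symm.injective (childIndex_injective k n h)))
    ((e.symm.surjective.iUnion_comp fun i => cell p (k + 1) (childIndex p k n i)).trans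
      (iUnion_cell_child hp k n))]
  exact e.symm.sum_comp fun i => Ψ (cell p (k + 1) (childIndex p k n i))

theorem HConds.integrableOn_and_le {I0 : Set (Fin d → ℝ)} {h : ℕ → (Fin d → ℝ) → ℝ}
    (hh : HConds p I0 h) (hI0 : volume.real I0 ≤ 1) (hI0' : volume I0 ≠ ⊤) :
    ∃ δ > (0 : ℝ), ∀ m, IntegrableOn (h m) I0 ∧ ∀ y ∈ I0, δ ≤ h m y := by
  obtain ⟨hmono, C, hC, ε, hε, hJ⟩ := hh
  refine ⟨ε / C, div_pos hε hC, fun m => ?_⟩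
  obtain ⟨s, J, hJL, -, hJU, hJC, hJε⟩ := hJ m
  have hJint : ∀ i, IntegrableOn (h m) (J i) := fun i => by
    by_contra hn
    exact absurd (hJε i) (by rw [integral_undef hn]; exact not_le.2 hε)
  refine ⟨by rw [← hJU]; exact integrableOn_finite_iUnion.2 hJint, fun y hy => ?_⟩
  obtain ⟨i, hi⟩ := Set.mem_iUnion.1 (hJU.symm ▸ hy)
  have hsub : J i ⊆ I0 := hJU ▸ Set.subset_iUnion J i
  have hmeas : MeasurableSet (J i) := by
    obtain ⟨k, n, hkn⟩ := hJL i
    rw [hkn, cell_eq_Icc]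
    exact measurableSet_Icc
  rw [div_le_iff₀' hC]
  calc ε ≤ ∫ x in J i, h m x := hJε i
    _ ≤ ∫ _ in J i, C * h m y := setIntegral_mono_on (hJint i)
        (integrableOn_const (measure_ne_top_of_subset hsub hI0')) hmeas
        fun x hx => hJC i x hx y hi
    _ = volume.real (J i) * (C * h m y) := by rw [setIntegral_const, smul_eq_mul]
    _ ≤ C * h m y := mul_le_of_le_one_left (mul_nonneg hC.le ((hmono y hy).1 m))
        ((measureReal_mono hsub hI0').trans hI0)

theorem ae_exists_notMem_of_tendsto_setIntegral {α : Type*} [MeasurableSpace α] {μ : Measure α}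
    {A : Set α} (hA : MeasurableSet A) (hA' : μ A ≠ ⊤) {h : ℕ → α → ℝ} {δ : ℝ} (hδ : 0 < δ)
    (hh : ∀ m, IntegrableOn (h m) A μ ∧ ∀ y ∈ A, δ ≤ h m y) {S : ℕ → Set α}
    (hS : Tendsto (fun m => ∫ x in A ∩ S m, h m x ∂μ) atTop (𝓝 0)) :
    ∀ᵐ x ∂μ.restrict A, ∃ m, x ∉ S m := by
  have hle : ∀ m, μ.real (A ∩ S m) * δ ≤ ∫ x in A ∩ S m, h m x ∂μ := fun m => by
    rw [← smul_eq_mul, ← setIntegral_const]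
    refine integral_mono_ae
      (integrableOn_const (measure_ne_top_of_subset Set.inter_subset_left hA'))
      ((hh m).1.mono_set Set.inter_subset_left) ?_
    exact ae_restrict_of_ae_restrict_of_subset Set.inter_subset_left
      ((ae_restrict_mem hA).mono fun x hx => (hh m).2 x hx)
  have hzero : μ.real (A ∩ ⋂ m, S m) * δ ≤ 0 := by
    refine ge_of_tendsto' hS fun m => le_trans ?_ (hle m)
    refine mul_le_mul_of_nonneg_right (measureReal_mono ?_ ?_) hδ.le
    · exact Set.inter_subset_inter_right _ (Set.iInter_subset S m)
    · exact measure_ne_top_of_subset Set.inter_subset_left hA'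
  have hnull : μ (A ∩ ⋂ m, S m) = 0 := by
    rw [← measureReal_eq_zero_iff (measure_ne_top_of_subset Set.inter_subset_left hA')]
    exact le_antisymm (nonpos_of_mul_nonpos_left hzero hδ) measureReal_nonneg
  rw [ae_restrict_iff' hA, ae_iff]
  refine measure_mono_null (fun x hx => ?_) hnull
  simpa using hx

theorem IsAdditive.average_eq {Ψ : Set (Fin d → ℝ) → ℂ} (hΨ : IsAdditive p Ψ)
    (hp : ∀ j i, 0 < p j i) (φ : ℂ →ₗ[ℝ] ℝ) (k : ℕ) (n : Fin d → ℤ) :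
    φ (Ψ (cell p k n)) / (volume (cell p k n)).toReal
      = childAverage p k (fun n' => φ (Ψ (cell p (k + 1) n'))
          / (volume (cell p (k + 1) n')).toReal) n := by
  have hprod : ∏ j, (p j k : ℝ) ≠ 0 :=
    Finset.prod_ne_zero_iff.2 fun j _ => Nat.cast_ne_zero.2 (hp j k).ne'
  simp only [childAverage, volume_cell_toReal, hΨ.eq_sum_child hp k n, map_sum,
    ← Finset.sum_div, mseq_succ, Nat.cast_mul, mul_inv, Finset.prod_mul_distrib,
    Finset.prod_inv_distrib]
  field_simp

end Grid

/-- **Remark (a.e. existence of the derivative is automatic).**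
Let `𝒫 = {Pʲ}` with `sup_{i,j} pʲᵢ < ∞` and let `Ψ` be a complex-valued additive function
on the `𝒫`-adic parallelepipeds of `I₀ = [0,1]^d`.  If there is a sequence `{h m}`
satisfying (h1)–(h3) on `I₀` with `∫_{{x ∈ I₀ : Ψ*(x) > h m x}} h m → 0`, then the
sequence `Ψ_k(x) = Ψ(I_{k,x})/μ(I_{k,x})` converges for almost every `x ∈ I₀`; in
particular `Ψ'(x)` exists almost everywhere. -/
theorem derivative_exists_ae
    (d : ℕ) (p : Fin d → ℕ → ℕ) (hp : ∀ j i, 2 ≤ p j i)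
    (M : ℕ) (hM : ∀ j i, p j i ≤ M)
    (Ψ : Set (Fin d → ℝ) → ℂ) (hΨ : IsAdditive p Ψ)
    (I0 : Set (Fin d → ℝ)) (hI0 : I0 = Set.Icc (0 : Fin d → ℝ) 1)
    (h : ℕ → (Fin d → ℝ) → ℝ) (hh : HConds p I0 h)
    (hsmall : Tendsto (fun m => ∫ x in I0 ∩ starGt p Ψ (h m), h m x) atTop (𝓝 0)) :
    ∀ᵐ x ∂(volume.restrict I0), ∃ c : ℂ,
      Tendsto (fun k => Ψ (cellAt p k x) / ((volume (cellAt p k x)).toReal : ℂ))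
        atTop (𝓝 c) := by
  have hp0 : ∀ j i, 0 < p j i := fun j i => zero_lt_two.trans_le (hp j i)
  have hunit : cell p 0 0 = I0 := by
    rw [hI0, cell_eq_Icc]
    congr 1 <;> funext j <;> simp [mseq]
  have hvol : volume.real I0 = 1 := by
    rw [← hunit, measureReal_def, volume_cell_toReal]
    simp [mseq]
  have hfin : volume I0 ≠ ⊤ := hunit ▸ volume_cell_ne_top p 0 0
  have hrestrict : (volume : Measure (Fin d → ℝ)).restrict (cellIndex p 0 ⁻¹' {0})
      = volume.restrict I0 := by
    rw [← hunit]
    exact Measure.restrict_congr_set (cellIndex_preimage_ae_eq_cell hp0 0 0)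
  obtain ⟨δ, hδ, hlow⟩ := hh.integrableOn_and_le hvol.le hfin
  have hmajorant := ae_exists_notMem_of_tendsto_setIntegral
    (hI0 ▸ measurableSet_Icc) hfin hδ hlow hsmall
  have hconv : ∀ φ : ℂ →ₗ[ℝ] ℝ, _ := fun φ =>
    ae_tendsto_of_childAverage hp0 hM (hΨ.average_eq hp0 φ)
  simp only [hrestrict] at hconv
  filter_upwards [hmajorant, hconv Complex.reLm, hconv Complex.imLm] with x ⟨m, hm⟩ hre him
  have hbound : ∀ k, ‖Ψ (cellAt p k x)‖ / (volume (cellAt p k x)).toReal ≤ h m x := fun k =>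
    not_lt.1 fun hlt => hm ⟨cellAt p k x, ⟨k, _, rfl⟩, mem_cellAt hp0 k x, hlt⟩
  have hcomp : ∀ φ : ℂ →ₗ[ℝ] ℝ, (∀ z, |φ z| ≤ ‖z‖) → ∀ k,
      |φ (Ψ (cellAt p k x)) / (volume (cellAt p k x)).toReal| ≤ h m x := fun φ hφ k => by
    rw [abs_div, abs_of_nonneg (ENNReal.toReal_nonneg (a := volume (cellAt p k x)))]
    exact (div_le_div_of_nonneg_right (hφ _) ENNReal.toReal_nonneg).trans (hbound k)
  obtain ⟨a, ha⟩ := hre ⟨h m x, hcomp _ Complex.abs_re_le_norm⟩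
  obtain ⟨b, hb⟩ := him ⟨h m x, hcomp _ Complex.abs_im_le_norm⟩
  refine ⟨(a : ℂ) + (b : ℂ) * Complex.I, ?_⟩
  have hlim := ((Complex.continuous_ofReal.tendsto a).comp ha).add
    (((Complex.continuous_ofReal.tendsto b).comp hb).mul_const Complex.I)
  refine hlim.congr fun k => ?_
  change ((((Ψ (cellAt p k x)).re / (volume (cellAt p k x)).toReal : ℝ) : ℂ)
    + (((Ψ (cellAt p k x)).im / (volume (cellAt p k x)).toReal : ℝ) : ℂ) * Complex.I) = _
  conv_rhs => rw [← Complex.re_add_im (Ψ (cellAt p k x))]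
  push_cast
  ring
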